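/- Let v : ℝ → Matrix (Fin n) (Fin m) ℂ be smooth with v(x)ᴴ v(x) = 1 for all x, let A(x) = v(x)ᴴ v'(x), let P solve P'(x) = −A(x) P(x), P(x₀) = 1, and let Ω(b,a) = P(b) P(a)⁻¹. Define Ω²(b,a) = (1/2) ( v(b)ᴴ v(a) + ( v(a)ᴴ v(b) )⁻¹ ) and Ω⁴(x+h, x) = (1/44) ( 90 Ω²(x+h, x+2h/3) Ω²(x+2h/3, x+h/3) Ω²(x+h/3, x) − 27 Ω²(x+h, x+2h/3) Ω²(x+2h/3, x) − 27 Ω²(x+h, x+h/3) Ω²(x+h/3, x) + 8 Ω²(x+h, x) ). Then for every fixed x ∈ ℝ, as h → 0, Ω(x+h, x) − Ω⁴(x+h, x) = O(h⁵). -/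

import Mathlib

open Matrix Filter Asymptotics

attribute [local instance] Matrix.normedAddCommGroup Matrix.normedSpace

/-- The order-2 approximation to parallel transport:
`Ω²(b,a) = ½ (v(b)ᴴ v(a) + (v(a)ᴴ v(b))⁻¹)`. -/
noncomputable def Omega2 {n m : ℕ} (v : ℝ → Matrix (Fin n) (Fin m) ℂ) (b a : ℝ) :
    Matrix (Fin m) (Fin m) ℂ :=
  (1 / 2 : ℂ) • ((v b)ᴴ * v a + ((v a)ᴴ * v b)⁻¹)

/-- The order-4 approximation to parallel transport:
`Ω⁴(x+h, x) = (1/44) (90 Ω²(x+h, x+2h/3) Ω²(x+2h/3, x+h/3) Ω²(x+h/3, x)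
  - 27 Ω²(x+h, x+2h/3) Ω²(x+2h/3, x) - 27 Ω²(x+h, x+h/3) Ω²(x+h/3, x) + 8 Ω²(x+h, x))`. -/
noncomputable def Omega4 {n m : ℕ} (v : ℝ → Matrix (Fin n) (Fin m) ℂ) (x h : ℝ) :
    Matrix (Fin m) (Fin m) ℂ :=
  (1 / 44 : ℂ) •
    ((90 : ℂ) • (Omega2 v (x + h) (x + 2 * h / 3) * Omega2 v (x + 2 * h / 3) (x + h / 3)
        * Omega2 v (x + h / 3) x)
      - (27 : ℂ) • (Omega2 v (x + h) (x + 2 * h / 3) * Omega2 v (x + 2 * h / 3) x)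
      - (27 : ℂ) • (Omega2 v (x + h) (x + h / 3) * Omega2 v (x + h / 3) x)
      + (8 : ℂ) • Omega2 v (x + h) x)

section Calculus

variable {k l p : ℕ}

lemma Asymptotics.IsBigO.matrix_mul {𝓕 : Filter ℝ} {f : ℝ → Matrix (Fin k) (Fin l) ℂ}
    {g : ℝ → Matrix (Fin l) (Fin p) ℂ} {a b : ℝ → ℝ} (hf : f =O[𝓕] a) (hg : g =O[𝓕] b) :
    (fun t => f t * g t) =O[𝓕] fun t => a t * b t := by
  refine isBigO_pi.2 fun i => isBigO_pi.2 fun j => ?_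
  simp only [Matrix.mul_apply]
  exact IsBigO.fun_sum fun r _ =>
    (isBigO_pi.1 (isBigO_pi.1 hf i) r).mul (isBigO_pi.1 (isBigO_pi.1 hg r) j)

lemma HasDerivAt.matrix_mul {f : ℝ → Matrix (Fin k) (Fin l) ℂ}
    {g : ℝ → Matrix (Fin l) (Fin p) ℂ} {f' : Matrix (Fin k) (Fin l) ℂ}
    {g' : Matrix (Fin l) (Fin p) ℂ} {x : ℝ} (hf : HasDerivAt f f' x) (hg : HasDerivAt g g' x) :
    HasDerivAt (fun t => f t * g t) (f' * g x + f x * g') x := by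
  refine hasDerivAt_pi.2 fun i => hasDerivAt_pi.2 fun j => ?_
  simp only [Matrix.mul_apply, Matrix.add_apply, ← Finset.sum_add_distrib]
  exact HasDerivAt.fun_sum fun r _ =>
    (hasDerivAt_pi.1 (hasDerivAt_pi.1 hf i) r).mul (hasDerivAt_pi.1 (hasDerivAt_pi.1 hg r) j)

lemma HasDerivAt.matrix_conjTranspose {f : ℝ → Matrix (Fin k) (Fin l) ℂ}
    {f' : Matrix (Fin k) (Fin l) ℂ} {x : ℝ} (hf : HasDerivAt f f' x) :
    HasDerivAt (fun t => (f t)ᴴ) f'ᴴ x :=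
  hasDerivAt_pi.2 fun i => hasDerivAt_pi.2 fun j =>
    (hasDerivAt_pi.1 (hasDerivAt_pi.1 hf j) i).star

lemma ContDiff.matrix_mul {N : WithTop ℕ∞} {f : ℝ → Matrix (Fin k) (Fin l) ℂ}
    {g : ℝ → Matrix (Fin l) (Fin p) ℂ} (hf : ContDiff ℝ N f) (hg : ContDiff ℝ N g) :
    ContDiff ℝ N (fun t => f t * g t) := by
  refine contDiff_pi.2 fun i => contDiff_pi.2 fun j => ?_
  simp only [Matrix.mul_apply]
  exact ContDiff.sum fun r _ =>
    (contDiff_pi.1 (contDiff_pi.1 hf i) r).mul (contDiff_pi.1 (contDiff_pi.1 hg r) j)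

lemma ContDiff.matrix_conjTranspose {N : WithTop ℕ∞} {f : ℝ → Matrix (Fin k) (Fin l) ℂ}
    (hf : ContDiff ℝ N f) : ContDiff ℝ N (fun t => (f t)ᴴ) :=
  contDiff_pi.2 fun i => contDiff_pi.2 fun j =>
    (starL' ℝ : ℂ ≃L[ℝ] ℂ).contDiff.comp (contDiff_pi.1 (contDiff_pi.1 hf j) i)

/-- Solutions of a linear differential equation with smooth coefficients are smooth. -/
lemma contDiff_of_linear_ode {B P : ℝ → Matrix (Fin k) (Fin k) ℂ}
    (hB : ContDiff ℝ (⊤ : ℕ∞) B) (hP : ∀ x, HasDerivAt P (B x * P x) x) (N : ℕ) :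
    ContDiff ℝ N P := by
  have hd : Differentiable ℝ P := fun x => (hP x).differentiableAt
  induction N with
  | zero => exact contDiff_zero.2 hd.continuous
  | succ N ih =>
    push_cast
    refine contDiff_succ_iff_deriv.2 ⟨hd, by simp, ?_⟩
    have e : deriv P = fun x => B x * P x := funext fun x => (hP x).deriv
    exact e ▸ (contDiff_infty.1 hB N).matrix_mul ih

end Calculus

section Expansion

variable {k l p : ℕ}

/-- `f h = a₀ + h a₁ + h² a₂ + h³ a₃ + h⁴ a₄ + O(h⁵)` as `h → 0`. -/
def HasExpansion (f : ℝ → Matrix (Fin k) (Fin l) ℂ) (a₀ a₁ a₂ a₃ a₄ : Matrix (Fin k) (Fin l) ℂ) :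
    Prop :=
  (fun h : ℝ => f h - (a₀ + h • a₁ + h ^ 2 • a₂ + h ^ 3 • a₃ + h ^ 4 • a₄)) =O[nhds 0]
    fun h : ℝ => h ^ 5

lemma isBigO_pow_smul {g : ℝ → Matrix (Fin k) (Fin l) ℂ} (hg : Continuous g) (N : ℕ) :
    (fun h : ℝ => h ^ N • g h) =O[nhds 0] fun h : ℝ => h ^ N := by
  simpa using (isBigO_refl (fun h : ℝ => h ^ N) (nhds 0)).smul ((hg.tendsto 0).isBigO_one ℝ)

lemma continuous_expansion (a₀ a₁ a₂ a₃ a₄ : Matrix (Fin k) (Fin l) ℂ) :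
    Continuous fun h : ℝ => a₀ + h • a₁ + h ^ 2 • a₂ + h ^ 3 • a₃ + h ^ 4 • a₄ := by
  fun_prop

lemma HasExpansion.of_eq {f g : ℝ → Matrix (Fin k) (Fin l) ℂ}
    {a₀ a₁ a₂ a₃ a₄ b₀ b₁ b₂ b₃ b₄ : Matrix (Fin k) (Fin l) ℂ}
    (hf : HasExpansion f a₀ a₁ a₂ a₃ a₄) (h : ∀ t, f t = g t) (h₀ : a₀ = b₀) (h₁ : a₁ = b₁)
    (h₂ : a₂ = b₂) (h₃ : a₃ = b₃) (h₄ : a₄ = b₄) : HasExpansion g b₀ b₁ b₂ b₃ b₄ := by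
  obtain rfl := funext h
  subst h₀ h₁ h₂ h₃ h₄
  exact hf

lemma HasExpansion.tendsto {f : ℝ → Matrix (Fin k) (Fin l) ℂ}
    {a₀ a₁ a₂ a₃ a₄ : Matrix (Fin k) (Fin l) ℂ} (hf : HasExpansion f a₀ a₁ a₂ a₃ a₄) :
    Tendsto f (nhds 0) (nhds a₀) := by
  have h5 : Tendsto (fun h : ℝ => h ^ 5) (nhds 0) (nhds 0) := by
    simpa using (continuous_pow 5).tendsto (0 : ℝ)
  have h := (hf.trans_tendsto h5).add ((continuous_expansion a₀ a₁ a₂ a₃ a₄).tendsto 0)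
  simp only [sub_add_cancel, zero_smul, add_zero, zero_add, ne_eq, OfNat.ofNat_ne_zero,
    not_false_eq_true, zero_pow] at h
  exact h

lemma HasExpansion.add {f g : ℝ → Matrix (Fin k) (Fin l) ℂ}
    {a₀ a₁ a₂ a₃ a₄ b₀ b₁ b₂ b₃ b₄ : Matrix (Fin k) (Fin l) ℂ}
    (hf : HasExpansion f a₀ a₁ a₂ a₃ a₄) (hg : HasExpansion g b₀ b₁ b₂ b₃ b₄) :
    HasExpansion (fun h => f h + g h) (a₀ + b₀) (a₁ + b₁) (a₂ + b₂) (a₃ + b₃) (a₄ + b₄) := by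
  refine (IsBigO.add hf hg).congr_left fun h => ?_
  module

lemma HasExpansion.const_smul {f : ℝ → Matrix (Fin k) (Fin l) ℂ}
    {a₀ a₁ a₂ a₃ a₄ : Matrix (Fin k) (Fin l) ℂ} (c : ℝ) (hf : HasExpansion f a₀ a₁ a₂ a₃ a₄) :
    HasExpansion (fun h => c • f h) (c • a₀) (c • a₁) (c • a₂) (c • a₃) (c • a₄) := by
  refine (IsBigO.const_smul_left hf c).congr_left fun h => ?_
  simp only [Pi.smul_apply]
  module

lemma HasExpansion.conjTranspose {f : ℝ → Matrix (Fin k) (Fin l) ℂ}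
    {a₀ a₁ a₂ a₃ a₄ : Matrix (Fin k) (Fin l) ℂ} (hf : HasExpansion f a₀ a₁ a₂ a₃ a₄) :
    HasExpansion (fun h => (f h)ᴴ) a₀ᴴ a₁ᴴ a₂ᴴ a₃ᴴ a₄ᴴ := by
  refine (IsBigO.congr' (IsBigO.norm_left hf) ?_ EventuallyEq.rfl).of_norm_left
  refine Eventually.of_forall fun h => ?_
  beta_reduce
  rw [← norm_conjTranspose]
  simp

lemma HasExpansion.mul {f : ℝ → Matrix (Fin k) (Fin l) ℂ} {g : ℝ → Matrix (Fin l) (Fin p) ℂ}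
    {a₀ a₁ a₂ a₃ a₄ : Matrix (Fin k) (Fin l) ℂ} {b₀ b₁ b₂ b₃ b₄ : Matrix (Fin l) (Fin p) ℂ}
    (hf : HasExpansion f a₀ a₁ a₂ a₃ a₄) (hg : HasExpansion g b₀ b₁ b₂ b₃ b₄) :
    HasExpansion (fun h => f h * g h) (a₀ * b₀) (a₀ * b₁ + a₁ * b₀)
      (a₀ * b₂ + a₁ * b₁ + a₂ * b₀) (a₀ * b₃ + a₁ * b₂ + a₂ * b₁ + a₃ * b₀)
      (a₀ * b₄ + a₁ * b₃ + a₂ * b₂ + a₃ * b₁ + a₄ * b₀) := by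
  have h₁ := IsBigO.matrix_mul hf (hg.tendsto.isBigO_one ℝ)
  have h₂ := IsBigO.matrix_mul
    (((continuous_expansion a₀ a₁ a₂ a₃ a₄).tendsto 0).isBigO_one ℝ) hg
  have h₃ := isBigO_pow_smul (g := fun h : ℝ => (a₁ * b₄ + a₂ * b₃ + a₃ * b₂ + a₄ * b₁)
    + h • (a₂ * b₄ + a₃ * b₃ + a₄ * b₂) + h ^ 2 • (a₃ * b₄ + a₄ * b₃) + h ^ 3 • (a₄ * b₄))
    (by fun_prop) 5
  simp only [mul_one, one_mul] at h₁ h₂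
  refine ((h₁.add h₂).add h₃).congr_left fun h => ?_
  simp only [Matrix.mul_add, Matrix.add_mul, Matrix.mul_sub, Matrix.sub_mul, Matrix.smul_mul,
    Matrix.mul_smul]
  module

lemma HasExpansion.inv {f : ℝ → Matrix (Fin k) (Fin k) ℂ} {a₂ a₃ a₄ : Matrix (Fin k) (Fin k) ℂ}
    (hf : HasExpansion f 1 0 a₂ a₃ a₄) :
    HasExpansion (fun h => (f h)⁻¹) 1 0 (-a₂) (-a₃) (a₂ * a₂ - a₄) := by
  have hlim := hf.tendsto
  have hinv : Tendsto (fun h => (f h)⁻¹) (nhds 0) (nhds 1) := by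
    have := (continuousAt_matrix_inv (1 : Matrix (Fin k) (Fin k) ℂ)
      (by rw [Matrix.det_one]; exact NormedRing.inverse_continuousAt (1 : ℂˣ))).tendsto.comp hlim
    rw [inv_one] at this
    exact this
  have hdet : ∀ᶠ h in nhds 0, (f h).det ≠ 0 := by
    have := ((continuous_id.matrix_det).tendsto (1 : Matrix (Fin k) (Fin k) ℂ)).comp hlim
    exact this.eventually_ne (by simp)
  set g : ℝ → Matrix (Fin k) (Fin k) ℂ := fun h =>
    1 + h • 0 + h ^ 2 • (-a₂) + h ^ 3 • (-a₃) + h ^ 4 • (a₂ * a₂ - a₄) with hg_def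
  have hg : HasExpansion g 1 0 (-a₂) (-a₃) (a₂ * a₂ - a₄) := by
    simp [HasExpansion, hg_def, isBigO_zero]
  have hone : HasExpansion (fun h => f h * g h) 1 0 0 0 0 :=
    (hf.mul hg).of_eq (fun _ => rfl) (by simp) (by simp) (by simp) (by simp)
      (by simp only [Matrix.mul_neg, Matrix.one_mul, Matrix.mul_one, Matrix.zero_mul,
        Matrix.mul_zero]; abel)
  have hfg := (hinv.isBigO_one ℝ).matrix_mul hone
  simp only [one_mul] at hfg
  refine (hfg.neg_left).congr' ?_ EventuallyEq.rfl
  filter_upwards [hdet] with h hh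
  have hcancel : (f h)⁻¹ * (f h * g h) = g h := by
    rw [← Matrix.mul_assoc, Matrix.nonsing_inv_mul _ (isUnit_iff_ne_zero.2 hh), Matrix.one_mul]
  rw [Matrix.mul_sub, hcancel]
  simp [hg_def]

lemma hasExpansion_taylor {f : ℝ → Matrix (Fin k) (Fin l) ℂ} (hf : ContDiff ℝ 5 f) (x c : ℝ) :
    HasExpansion (fun h => f (x + c * h)) (f x) (c • deriv f x)
      ((c ^ 2 / 2) • iteratedDeriv 2 f x) ((c ^ 3 / 6) • iteratedDeriv 3 f x)
      ((c ^ 4 / 24) • iteratedDeriv 4 f x) := by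
  have h₁ := (taylor_isLittleO_univ (x₀ := x) (n := 5) (by exact_mod_cast hf)).isBigO
  have hlim : Tendsto (fun h : ℝ => x + c * h) (nhds 0) (nhds x) := by
    have : Continuous fun h : ℝ => x + c * h := by fun_prop
    simpa using this.tendsto 0
  have h₂ := h₁.comp_tendsto hlim
  have h₃ : ((fun y => (y - x) ^ 5) ∘ fun h : ℝ => x + c * h) =O[nhds 0] fun h : ℝ => h ^ 5 := by
    have := (isBigO_refl (fun h : ℝ => h ^ 5) (nhds 0)).const_mul_left (c ^ 5)
    refine this.congr_left fun h => ?_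
    simp [mul_pow]
  have h₄ := isBigO_pow_smul (g := fun _ : ℝ => (c ^ 5 / 120) • iteratedDeriv 5 f x)
    continuous_const 5
  refine ((h₂.trans h₃).add h₄).congr_left fun h => ?_
  simp only [Function.comp, taylor_within_apply, Finset.sum_range_succ, Finset.sum_range_zero,
    iteratedDerivWithin_univ, Nat.factorial, add_sub_cancel_left]
  have e : iteratedDeriv 1 f = deriv f := iteratedDeriv_one
  rw [iteratedDeriv_zero, e]
  push_cast
  module

end Expansion

section Horizontal

variable {n m : ℕ}

/-- The order-2 approximation to parallel transport along a horizontal frame is trivial up to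
third order, with an explicit form of the next two terms. -/
lemma hasExpansion_Omega2 {w : ℝ → Matrix (Fin n) (Fin m) ℂ} (hw : ContDiff ℝ 5 w)
    (horth : ∀ t, (w t)ᴴ * w t = 1) (hhor : ∀ t, (w t)ᴴ * deriv w t = 0) (x : ℝ) :
    ∃ S T U : Matrix (Fin m) (Fin m) ℂ, ∀ b a : ℝ,
      HasExpansion (fun h => Omega2 w (x + b * h) (x + a * h)) 1 0 0 ((b - a) ^ 3 • S)
        (((b - a) ^ 3 * (b + a)) • T + (b - a) ^ 4 • U) := by
  set w₁ := deriv w with hw₁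
  set w₂ := iteratedDeriv 2 w with hw₂
  set w₃ := iteratedDeriv 3 w with hw₃
  set w₄ := iteratedDeriv 4 w with hw₄
  have d₀ : ∀ t, HasDerivAt w (w₁ t) t := fun t =>
    (hw.differentiable (by norm_num) t).hasDerivAt
  have d : ∀ N : ℕ, N < 5 → ∀ t, HasDerivAt (iteratedDeriv N w) (iteratedDeriv (N + 1) w t) t := by
    intro N hN t
    rw [iteratedDeriv_succ]
    exact (hw.differentiable_iteratedDeriv N (by exact_mod_cast hN) t).hasDerivAt
  have d₁ : ∀ t, HasDerivAt w₁ (w₂ t) t := fun t => by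
    have e : iteratedDeriv 1 w = w₁ := iteratedDeriv_one
    have := d 1 (by norm_num) t
    rwa [e] at this
  have d₂ : ∀ t, HasDerivAt w₂ (w₃ t) t := d 2 (by norm_num)
  have d₃ : ∀ t, HasDerivAt w₃ (w₄ t) t := d 3 (by norm_num)
  have r₂ : ∀ t, (w₁ t)ᴴ * w₁ t + (w t)ᴴ * w₂ t = 0 := fun t =>
    ((d₀ t).matrix_conjTranspose.matrix_mul (d₁ t)).unique
      ((hasDerivAt_const t 0).congr_of_eventuallyEq (Eventually.of_forall hhor))
  have r₃ := fun t =>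
    (((d₁ t).matrix_conjTranspose.matrix_mul (d₁ t)).add
      ((d₀ t).matrix_conjTranspose.matrix_mul (d₂ t))).unique
      ((hasDerivAt_const t 0).congr_of_eventuallyEq (Eventually.of_forall r₂))
  have r₄ := fun t =>
    ((((d₂ t).matrix_conjTranspose.matrix_mul (d₁ t)).add
        ((d₁ t).matrix_conjTranspose.matrix_mul (d₂ t))).add
      (((d₁ t).matrix_conjTranspose.matrix_mul (d₂ t)).add
        ((d₀ t).matrix_conjTranspose.matrix_mul (d₃ t)))).unique
      ((hasDerivAt_const t 0).congr_of_eventuallyEq (Eventually.of_forall r₃))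
  have g00 := horth x
  have g01 := hhor x
  have g02 := eq_neg_of_add_eq_zero_right (r₂ x)
  have g03 : (w x)ᴴ * w₃ x = -((w₂ x)ᴴ * w₁ x + (2 : ℝ) • ((w₁ x)ᴴ * w₂ x)) := by
    rw [← sub_eq_zero, ← r₃ x]
    module
  have g04 : (w x)ᴴ * w₄ x = -((w₃ x)ᴴ * w₁ x + (3 : ℝ) • ((w₂ x)ᴴ * w₂ x)
      + (3 : ℝ) • ((w₁ x)ᴴ * w₃ x)) := by
    rw [← sub_eq_zero, ← r₄ x]
    module
  have g10 := congrArg Matrix.conjTranspose g01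
  have g20 := congrArg Matrix.conjTranspose g02
  have g30 := congrArg Matrix.conjTranspose g03
  have g40 := congrArg Matrix.conjTranspose g04
  simp only [conjTranspose_mul, conjTranspose_conjTranspose, conjTranspose_neg,
    conjTranspose_add, conjTranspose_smul, conjTranspose_zero, star_trivial] at g10 g20 g30 g40
  have key : ∀ b a : ℝ, HasExpansion (fun h => (w (x + b * h))ᴴ * w (x + a * h)) 1 0
      ((-(b - a) ^ 2 / 2) • ((w₁ x)ᴴ * w₁ x))
      ((b ^ 2 * a / 2 - b ^ 3 / 3 - a ^ 3 / 6) • ((w₂ x)ᴴ * w₁ x)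
        + (b * a ^ 2 / 2 - b ^ 3 / 6 - a ^ 3 / 3) • ((w₁ x)ᴴ * w₂ x))
      ((b ^ 3 * a / 6 - b ^ 4 / 8 - a ^ 4 / 24) • ((w₃ x)ᴴ * w₁ x)
        + (b ^ 2 * a ^ 2 / 4 - b ^ 4 / 8 - a ^ 4 / 8) • ((w₂ x)ᴴ * w₂ x)
        + (b * a ^ 3 / 6 - b ^ 4 / 24 - a ^ 4 / 8) • ((w₁ x)ᴴ * w₃ x)) := by
    intro b a
    refine ((hasExpansion_taylor hw x b).conjTranspose.mul (hasExpansion_taylor hw x a)).of_eq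
      (fun _ => rfl) g00 ?_ ?_ ?_ ?_ <;>
    simp only [← hw₁, ← hw₂, ← hw₃, ← hw₄, conjTranspose_smul, star_trivial, Matrix.smul_mul,
      Matrix.mul_smul, g01, g02, g03, g04, g10, g20, g30, g40] <;>
    module
  refine ⟨(1 / 12 : ℝ) • ((w₁ x)ᴴ * w₂ x - (w₂ x)ᴴ * w₁ x),
    (1 / 24 : ℝ) • ((w₁ x)ᴴ * w₃ x - (w₃ x)ᴴ * w₁ x),
    (1 / 8 : ℝ) • ((w₁ x)ᴴ * w₁ x * ((w₁ x)ᴴ * w₁ x)), fun b a => ?_⟩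
  refine (((key b a).add (key a b).inv).const_smul (1 / 2)).of_eq (fun h => ?_) ?_ ?_ ?_ ?_ ?_
  · rw [Omega2, ← Complex.coe_smul]
    norm_num
  · module
  · module
  · module
  · module
  · simp only [Matrix.smul_mul, Matrix.mul_smul]
    module

lemma hasExpansion_Omega4 {w : ℝ → Matrix (Fin n) (Fin m) ℂ} (hw : ContDiff ℝ 5 w)
    (horth : ∀ t, (w t)ᴴ * w t = 1) (hhor : ∀ t, (w t)ᴴ * deriv w t = 0) (x : ℝ) :
    HasExpansion (fun h => Omega4 w x h) 1 0 0 0 0 := by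
  obtain ⟨S, T, U, H⟩ := hasExpansion_Omega2 hw horth hhor x
  have h₁ := ((H 1 (2 / 3)).mul (H (2 / 3) (1 / 3))).mul (H (1 / 3) 0)
  have h₂ := (H 1 (2 / 3)).mul (H (2 / 3) 0)
  have h₃ := (H 1 (1 / 3)).mul (H (1 / 3) 0)
  refine (((((h₁.const_smul 90).add (h₂.const_smul (-27))).add (h₃.const_smul (-27))).add
    ((H 1 0).const_smul 8)).const_smul (1 / 44)).of_eq (fun h => ?_) ?_ ?_ ?_ ?_ ?_
  · have e₁ : x + 2 * h / 3 = x + 2 / 3 * h := by ring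
    have e₂ : x + h / 3 = x + 1 / 3 * h := by ring
    simp only [Omega4, e₁, e₂, one_mul, zero_mul, add_zero, ← Complex.coe_smul]
    push_cast
    module
  all_goals
    simp only [Matrix.mul_zero, Matrix.zero_mul, Matrix.one_mul, Matrix.mul_one, add_zero]
    module

end Horizontal

section Gauge

variable {n m : ℕ}

lemma Omega2_mul {w : ℝ → Matrix (Fin n) (Fin m) ℂ} {Q : ℝ → Matrix (Fin m) (Fin m) ℂ}
    (hQ : ∀ t, (Q t)ᴴ * Q t = 1) (b a : ℝ) :
    Omega2 (fun t => w t * Q t) b a = (Q b)ᴴ * Omega2 w b a * Q a := by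
  have hb : (Q b)⁻¹ = (Q b)ᴴ := Matrix.inv_eq_left_inv (hQ b)
  have ha : ((Q a)ᴴ)⁻¹ = Q a := Matrix.inv_eq_right_inv (hQ a)
  have e : (w a * Q a)ᴴ * (w b * Q b) = (Q a)ᴴ * ((w a)ᴴ * w b) * Q b := by
    simp only [conjTranspose_mul, Matrix.mul_assoc]
  rw [Omega2, Omega2, e, Matrix.mul_inv_rev, Matrix.mul_inv_rev, ha, hb]
  simp only [conjTranspose_mul, Matrix.mul_assoc, Matrix.mul_smul, Matrix.smul_mul,
    Matrix.mul_add, Matrix.add_mul]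

/-- `Ω⁴` transforms like a parallel transport under a unitary change of frame. -/
lemma Omega4_mul {w : ℝ → Matrix (Fin n) (Fin m) ℂ} {Q : ℝ → Matrix (Fin m) (Fin m) ℂ}
    (hQ : ∀ t, (Q t)ᴴ * Q t = 1) (x h : ℝ) :
    Omega4 (fun t => w t * Q t) x h = (Q (x + h))ᴴ * Omega4 w x h * Q x := by
  have hQ' : ∀ t, Q t * (Q t)ᴴ = 1 := fun t => mul_eq_one_comm.1 (hQ t)
  have hc : ∀ t (M : Matrix (Fin m) (Fin m) ℂ), Q t * ((Q t)ᴴ * M) = M := fun t M => by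
    rw [← Matrix.mul_assoc, hQ', Matrix.one_mul]
  simp only [Omega4, Omega2_mul hQ, Matrix.mul_assoc, hc, Matrix.mul_smul, Matrix.smul_mul,
    Matrix.mul_add, Matrix.add_mul, Matrix.mul_sub, Matrix.sub_mul]

end Gauge

/-- The order-4 approximation to parallel transport of the induced connection: if `v` is smooth
with `vᴴ v = 1`, `A = vᴴ v'`, `P' = -A P`, `P x₀ = 1` and `Ω(b,a) = P(b) P(a)⁻¹`, then
`Ω(x+h, x) - Ω⁴(x+h, x) = O(h⁵)` as `h → 0`. -/
theorem order_four_approximation {n m : ℕ}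
    (v : ℝ → Matrix (Fin n) (Fin m) ℂ)
    (hv : ContDiff ℝ (⊤ : ℕ∞) v)
    (horth : ∀ x : ℝ, (v x)ᴴ * v x = 1)
    (P : ℝ → Matrix (Fin m) (Fin m) ℂ)
    (x₀ : ℝ)
    (hP : ∀ x : ℝ, HasDerivAt P (-((v x)ᴴ * deriv v x) * P x) x)
    (hP₀ : P x₀ = 1)
    (Ω : ℝ → ℝ → Matrix (Fin m) (Fin m) ℂ)
    (hΩ : ∀ b a : ℝ, Ω b a = P b * (P a)⁻¹)
    (x : ℝ) :
    (fun h : ℝ => Ω (x + h) x - Omega4 v x h) =O[nhds 0] fun h : ℝ => h ^ 5 := by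
  have hdv : ∀ t, HasDerivAt v (deriv v t) t := fun t =>
    (hv.differentiable (by simp) t).hasDerivAt
  have hskew : ∀ t, (deriv v t)ᴴ * v t + (v t)ᴴ * deriv v t = 0 := fun t =>
    ((hdv t).matrix_conjTranspose.matrix_mul (hdv t)).unique
      ((hasDerivAt_const t 1).congr_of_eventuallyEq (Eventually.of_forall horth))
  have hPP : ∀ t, (P t)ᴴ * P t = 1 := by
    have hd : ∀ t, HasDerivAt (fun t => (P t)ᴴ * P t) 0 t := fun t => by
      convert (hP t).matrix_conjTranspose.matrix_mul (hP t) using 1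
      have e : (0 : Matrix (Fin m) (Fin m) ℂ)
          = -((P t)ᴴ * ((deriv v t)ᴴ * v t + (v t)ᴴ * deriv v t) * P t) := by
        simp [hskew t]
      rw [e]
      simp only [conjTranspose_mul, conjTranspose_neg, conjTranspose_conjTranspose,
        Matrix.mul_neg, Matrix.neg_mul, Matrix.mul_add, Matrix.add_mul, Matrix.mul_assoc, neg_add]
    intro t
    rw [is_const_of_deriv_eq_zero (fun s => (hd s).differentiableAt) (fun s => (hd s).deriv) t x₀,
      hP₀]
    simp
  have hPP' : ∀ t, P t * (P t)ᴴ = 1 := fun t => mul_eq_one_comm.1 (hPP t)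
  have hPsmooth : ContDiff ℝ 5 P := by
    have hv' : ContDiff ℝ (⊤ : ℕ∞) (deriv v) := (contDiff_infty_iff_deriv.1 hv).2
    exact_mod_cast contDiff_of_linear_ode (hv.matrix_conjTranspose.matrix_mul hv').neg hP 5
  set w : ℝ → Matrix (Fin n) (Fin m) ℂ := fun t => v t * P t with hw_def
  have hw : ContDiff ℝ 5 w := (by exact_mod_cast contDiff_infty.1 hv 5 : ContDiff ℝ 5 v).matrix_mul hPsmooth
  have hworth : ∀ t, (w t)ᴴ * w t = 1 := fun t => by
    rw [hw_def, conjTranspose_mul, Matrix.mul_assoc, ← Matrix.mul_assoc (v t)ᴴ, horth,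
      Matrix.one_mul, hPP]
  have hwhor : ∀ t, (w t)ᴴ * deriv w t = 0 := fun t => by
    have e : (v t)ᴴ * (deriv v t * P t + v t * (-((v t)ᴴ * deriv v t) * P t)) = 0 := by
      rw [Matrix.mul_add, ← Matrix.mul_assoc _ (v t), horth]
      simp [Matrix.mul_assoc]
    have hd : deriv w t = _ := ((hdv t).matrix_mul (hP t)).deriv
    rw [hd, conjTranspose_mul, Matrix.mul_assoc, e,
      Matrix.mul_zero]
  have hvw : v = fun t => w t * (P t)ᴴ := funext fun t => by
    rw [hw_def, Matrix.mul_assoc, hPP', Matrix.mul_one]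
  have hb : (fun h => P (x + h)) =O[nhds 0] fun _ => (1 : ℝ) := by
    have : Continuous fun h => P (x + h) := hPsmooth.continuous.comp (by fun_prop)
    exact (this.tendsto 0).isBigO_one ℝ
  have main := (hb.matrix_mul (hasExpansion_Omega4 hw hworth hwhor x)).matrix_mul
    (isBigO_const_const (P x)ᴴ (one_ne_zero (α := ℝ)) (nhds 0))
  simp only [one_mul, mul_one] at main
  refine main.neg_left.congr_left fun h => ?_
  have hO : Omega4 v x h = P (x + h) * Omega4 w x h * (P x)ᴴ := by
    conv_lhs => rw [hvw]
    rw [Omega4_mul (fun t => by rw [conjTranspose_conjTranspose, hPP']),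
      conjTranspose_conjTranspose]
  rw [hΩ, hO, Matrix.inv_eq_left_inv (hPP x)]
  simp [Matrix.mul_sub, Matrix.sub_mul]
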